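/- arXiv:2509.12376 — 2 statements merged into one kernel-verified Lean document; each statement's English description precedes it below -/
import Mathlib

section
/- For n = 4, the complex Δ₄ on the 12-element ground set {x_{ij} : 1 ≤ i ≤ 4, 1 ≤ j ≤ 3} with minimal nonfaces given by subsets of profile a permutation of (3,3,0,0), (3,2,2,0), or (2,2,2,2) is pure of dimension 6 and has exactly 648 facets. -/
open Finset

/-- The profile of a subset `U` of the ground set `{x_{ij}} = Fin n × Fin 3`:
`profile U i` is the number of `j` with `x_{ij} ∈ U`. -/
def profileOf {n : ℕ} (U : Finset (Fin n × Fin 3)) (i : Fin n) : ℕ :=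
  (U.filter (fun p => p.1 = i)).card

/-- A profile is *bad* if, up to permutation of the indices, it equals
`(3,3,0,…,0)`, `(3,2,2,0,…,0)` or `(2,2,2,2,0,…,0)`. -/
def IsBadProfile {n : ℕ} (c : Fin n → ℕ) : Prop :=
  (∃ i j, i ≠ j ∧ c i = 3 ∧ c j = 3 ∧ ∀ k, k ≠ i → k ≠ j → c k = 0) ∨
  (∃ i j k, i ≠ j ∧ i ≠ k ∧ j ≠ k ∧ c i = 3 ∧ c j = 2 ∧ c k = 2 ∧
    ∀ l, l ≠ i → l ≠ j → l ≠ k → c l = 0) ∨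
  (∃ i j k l, i ≠ j ∧ i ≠ k ∧ i ≠ l ∧ j ≠ k ∧ j ≠ l ∧ k ≠ l ∧
    c i = 2 ∧ c j = 2 ∧ c k = 2 ∧ c l = 2 ∧
    ∀ m, m ≠ i → m ≠ j → m ≠ k → m ≠ l → c m = 0)

/-- `U` is a face of the simplicial complex `Δₙ`: it contains no (minimal)
nonface, i.e. no subset whose profile is bad. -/
def IsFaceD (n : ℕ) (U : Finset (Fin n × Fin 3)) : Prop :=
  ¬ ∃ W : Finset (Fin n × Fin 3), W ⊆ U ∧ IsBadProfile (profileOf W)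

/-- `U` is a facet (maximal face) of `Δₙ`. -/
def IsFacetD (n : ℕ) (U : Finset (Fin n × Fin 3)) : Prop :=
  IsFaceD n U ∧ ∀ W : Finset (Fin n × Fin 3), IsFaceD n W → U ⊆ W → W = U

/-- A profile is a permutation of `(3,2,1,1,…,1)`. -/
def IsProfile321 {n : ℕ} (c : Fin n → ℕ) : Prop :=
  ∃ i j, i ≠ j ∧ c i = 3 ∧ c j = 2 ∧ ∀ k, k ≠ i → k ≠ j → c k = 1

/-- A profile is a permutation of `(2,2,2,1,…,1)`. -/
def IsProfile2221 {n : ℕ} (c : Fin n → ℕ) : Prop :=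
  ∃ i j k, i ≠ j ∧ i ≠ k ∧ j ≠ k ∧ c i = 2 ∧ c j = 2 ∧ c k = 2 ∧
    ∀ l, l ≠ i → l ≠ j → l ≠ k → c l = 1


/-- The row `i` of `U`. -/
def rowD (U : Finset (Fin 4 × Fin 3)) (i : Fin 4) : Finset (Fin 3) :=
  univ.filter (fun j => (i, j) ∈ U)

/-- The set with prescribed rows. -/
def ofRowsD (g : Fin 4 → Finset (Fin 3)) : Finset (Fin 4 × Fin 3) :=
  univ.filter (fun p => p.2 ∈ g p.1)

lemma profileOf_eq_row (U : Finset (Fin 4 × Fin 3)) (i : Fin 4) :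
    profileOf U i = (rowD U i).card := by
  unfold profileOf rowD
  symm
  apply Finset.card_bij (fun j _ => (i, j))
  · intro j hj
    simpa using hj
  · intro a _ b _ h
    simpa using h
  · rintro ⟨a, b⟩ h
    simp only [mem_filter] at h
    obtain ⟨h1, h2⟩ := h
    subst h2
    exact ⟨b, by simpa using h1, rfl⟩

lemma rowD_ofRowsD (g : Fin 4 → Finset (Fin 3)) (i : Fin 4) : rowD (ofRowsD g) i = g i := by
  ext j; simp [rowD, ofRowsD]

lemma ofRowsD_rowD (U : Finset (Fin 4 × Fin 3)) : ofRowsD (rowD U) = U := by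
  ext ⟨i, j⟩; simp [rowD, ofRowsD]

lemma profileOf_le_three (U : Finset (Fin 4 × Fin 3)) (i : Fin 4) : profileOf U i ≤ 3 := by
  rw [profileOf_eq_row]
  simpa using Finset.card_le_univ (rowD U i)

lemma card_eq_sum_profile (U : Finset (Fin 4 × Fin 3)) :
    U.card = profileOf U 0 + profileOf U 1 + profileOf U 2 + profileOf U 3 := by
  have h := Finset.card_eq_sum_card_fiberwise (f := Prod.fst) (s := U) (t := (univ : Finset (Fin 4)))
    (by intro x _; simp)
  rw [h, Fin.sum_univ_four]
  rfl

lemma profileOf_mono {U W : Finset (Fin 4 × Fin 3)} (h : W ⊆ U) (i : Fin 4) :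
    profileOf W i ≤ profileOf U i :=
  Finset.card_le_card (Finset.filter_subset_filter _ h)

lemma exists_subset_profile (U : Finset (Fin 4 × Fin 3)) (c : Fin 4 → ℕ)
    (h : ∀ i, c i ≤ profileOf U i) : ∃ W, W ⊆ U ∧ profileOf W = c := by
  have h' : ∀ i, ∃ t, t ⊆ rowD U i ∧ t.card = c i := fun i =>
    Finset.exists_subset_card_eq (by rw [← profileOf_eq_row]; exact h i)
  choose g hg hc using h'
  refine ⟨ofRowsD g, ?_, ?_⟩
  · rintro ⟨i, j⟩ hp
    have : j ∈ g i := by simpa [ofRowsD] using hp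
    simpa [rowD] using hg i this
  · funext i
    rw [profileOf_eq_row, rowD_ofRowsD, hc]

/-- The condition on a profile that characterises nonfaces. -/
def DomBad (c : Fin 4 → ℕ) : Prop :=
  (∃ i j, i ≠ j ∧ 3 ≤ c i ∧ 3 ≤ c j) ∨
  (∃ i j k, i ≠ j ∧ i ≠ k ∧ j ≠ k ∧ 3 ≤ c i ∧ 2 ≤ c j ∧ 2 ≤ c k) ∨
  (∀ i, 2 ≤ c i)

instance (c : Fin 4 → ℕ) : Decidable (DomBad c) := by unfold DomBad; infer_instance

lemma isFaceD_iff (U : Finset (Fin 4 × Fin 3)) : IsFaceD 4 U ↔ ¬ DomBad (profileOf U) := by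
  unfold IsFaceD
  refine not_congr ⟨?_, ?_⟩
  · rintro ⟨W, hW, h⟩
    have m := profileOf_mono hW
    rcases h with ⟨i, j, hij, h1, h2, -⟩ | ⟨i, j, k, hij, hik, hjk, h1, h2, h3, -⟩ |
      ⟨i, j, k, l, hij, hik, hil, hjk, hjl, hkl, h1, h2, h3, h4, -⟩
    · exact Or.inl ⟨i, j, hij, h1 ▸ m i, h2 ▸ m j⟩
    · exact Or.inr (Or.inl ⟨i, j, k, hij, hik, hjk, h1 ▸ m i, h2 ▸ m j, h3 ▸ m k⟩)
    · refine Or.inr (Or.inr fun x => ?_)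
      have hx : x = i ∨ x = j ∨ x = k ∨ x = l := by omega
      rcases hx with rfl | rfl | rfl | rfl
      · exact h1 ▸ m _
      · exact h2 ▸ m _
      · exact h3 ▸ m _
      · exact h4 ▸ m _
  · rintro (⟨i, j, hij, h1, h2⟩ | ⟨i, j, k, hij, hik, hjk, h1, h2, h3⟩ | h)
    · obtain ⟨W, hW, hc⟩ := exists_subset_profile U
        (fun x => if x = i then 3 else if x = j then 3 else 0)
        (by intro x; split_ifs with a b <;> simp_all)
      refine ⟨W, hW, Or.inl ⟨i, j, hij, ?_, ?_, ?_⟩⟩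
      · simp [hc]
      · simp [hc]
      · intro k hk hk'; simp [hc, hk, hk']
    · obtain ⟨W, hW, hc⟩ := exists_subset_profile U
        (fun x => if x = i then 3 else if x = j then 2 else if x = k then 2 else 0)
        (by intro x; split_ifs with a b <;> simp_all)
      refine ⟨W, hW, Or.inr (Or.inl ⟨i, j, k, hij, hik, hjk, ?_, ?_, ?_, ?_⟩)⟩
      · simp [hc]
      · simp [hc, hij.symm]
      · simp [hc, hik.symm]
      · intro l h1 h2 h3; simp [hc, h1, h2, h3]
    · obtain ⟨W, hW, hc⟩ := exists_subset_profile U (fun _ => 2) h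
      refine ⟨W, hW, Or.inr (Or.inr ⟨0, 1, 2, 3, by decide, by decide, by decide, by decide,
        by decide, by decide, ?_, ?_, ?_, ?_, ?_⟩)⟩
      · simp [hc]
      · simp [hc]
      · simp [hc]
      · simp [hc]
      · intro m h0 h1 h2 h3
        omega

/-- Explicit form of `DomBad` on four numbers. -/
def badB (a b c d : ℕ) : Bool :=
  let t := fun x : ℕ => if 3 ≤ x then 1 else 0
  let w := fun x : ℕ => if 2 ≤ x then 1 else 0
  let T := t a + t b + t c + t d
  let S := w a + w b + w c + w d
  decide (2 ≤ T) || (decide (1 ≤ T) && decide (3 ≤ S)) || decide (4 ≤ S)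

lemma domBad_fin : ∀ a b c d : Fin 4,
    (DomBad ![a.1, b.1, c.1, d.1] ↔ badB a b c d = true) := by
  decide +kernel

lemma domBad_iff (f : Fin 4 → ℕ) (hf : ∀ i, f i ≤ 3) :
    DomBad f ↔ badB (f 0) (f 1) (f 2) (f 3) = true := by
  have := domBad_fin ⟨f 0, by have := hf 0; omega⟩ ⟨f 1, by have := hf 1; omega⟩
    ⟨f 2, by have := hf 2; omega⟩ ⟨f 3, by have := hf 3; omega⟩
  have e : ![f 0, f 1, f 2, f 3] = f := by
    funext i; fin_cases i <;> rfl
  simpa only [e] using this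

lemma face_le : ∀ a b c d : Fin 4, badB a b c d = false → a.1 + b.1 + c.1 + d.1 ≤ 7 := by
  decide +kernel

lemma facet_eq : ∀ a b c d : Fin 4, badB a b c d = false →
    (a.1 < 3 → badB (a + 1 : ℕ) b c d = true) → (b.1 < 3 → badB a (b + 1 : ℕ) c d = true) →
    (c.1 < 3 → badB a b (c + 1 : ℕ) d = true) → (d.1 < 3 → badB a b c (d + 1 : ℕ) = true) →
    a.1 + b.1 + c.1 + d.1 = 7 := by
  decide +kernel

lemma isFaceD_iff' (U : Finset (Fin 4 × Fin 3)) : IsFaceD 4 U ↔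
    badB (profileOf U 0) (profileOf U 1) (profileOf U 2) (profileOf U 3) = false := by
  rw [isFaceD_iff, domBad_iff _ (profileOf_le_three U)]
  simp

lemma face_card_le (U : Finset (Fin 4 × Fin 3)) (h : IsFaceD 4 U) : U.card ≤ 7 := by
  rw [card_eq_sum_profile]
  rw [isFaceD_iff'] at h
  have l := profileOf_le_three U
  exact face_le ⟨_, Nat.lt_succ_of_le (l 0)⟩ ⟨_, Nat.lt_succ_of_le (l 1)⟩
    ⟨_, Nat.lt_succ_of_le (l 2)⟩ ⟨_, Nat.lt_succ_of_le (l 3)⟩ h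

lemma facet_insert (U : Finset (Fin 4 × Fin 3)) (h : IsFacetD 4 U) (i : Fin 4)
    (hi : profileOf U i < 3) : ∃ V : Finset (Fin 4 × Fin 3), ¬ IsFaceD 4 V ∧
      ∀ k, profileOf V k = if k = i then profileOf U i + 1 else profileOf U k := by
  have : ∃ j, j ∉ rowD U i := by
    by_contra hc
    push Not at hc
    rw [profileOf_eq_row, Finset.eq_univ_of_forall hc] at hi
    simp at hi
  obtain ⟨j, hj⟩ := this
  have hj' : (i, j) ∉ U := by simpa [rowD] using hj
  refine ⟨insert (i, j) U, fun hf => ?_, fun k => ?_⟩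
  · have := h.2 _ hf (Finset.subset_insert _ _)
    exact hj' (this ▸ Finset.mem_insert_self _ _)
  · unfold profileOf
    rw [Finset.filter_insert]
    by_cases hk : k = i
    · subst hk
      simp [hj']
    · simp [hk, Ne.symm hk]

lemma facet_card (U : Finset (Fin 4 × Fin 3)) (h : IsFacetD 4 U) : U.card = 7 := by
  rw [card_eq_sum_profile]
  have hf := (isFaceD_iff' U).1 h.1
  have l := profileOf_le_three U
  refine facet_eq ⟨_, Nat.lt_succ_of_le (l 0)⟩ ⟨_, Nat.lt_succ_of_le (l 1)⟩
    ⟨_, Nat.lt_succ_of_le (l 2)⟩ ⟨_, Nat.lt_succ_of_le (l 3)⟩ hf ?_ ?_ ?_ ?_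
  all_goals
    intro hi
    obtain ⟨V, hV, hp⟩ := facet_insert U h _ hi
    rw [isFaceD_iff'] at hV
    simpa [hp] using hV

lemma facet_iff (U : Finset (Fin 4 × Fin 3)) : IsFacetD 4 U ↔ IsFaceD 4 U ∧ U.card = 7 := by
  refine ⟨fun h => ⟨h.1, facet_card U h⟩, fun h => ⟨h.1, fun W hW hUW => ?_⟩⟩
  exact (Finset.eq_of_subset_of_card_le hUW (by rw [h.2]; exact face_card_le W hW)).symm

/-- Indicator of the facet profiles. -/
def facetInd (a b c d : ℕ) : ℕ :=
  if badB a b c d = false ∧ a + b + c + d = 7 then 1 else 0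

/-- Decomposition of a subset into its four rows. -/
def rowsEquivD : Finset (Fin 4 × Fin 3) ≃
    Finset (Fin 3) × Finset (Fin 3) × Finset (Fin 3) × Finset (Fin 3) where
  toFun U := (rowD U 0, rowD U 1, rowD U 2, rowD U 3)
  invFun g := ofRowsD ![g.1, g.2.1, g.2.2.1, g.2.2.2]
  left_inv U := by
    have e : ![rowD U 0, rowD U 1, rowD U 2, rowD U 3] = rowD U := by
      funext i; fin_cases i <;> rfl
    simp only [e, ofRowsD_rowD]
  right_inv g := by
    simp [rowD_ofRowsD]

/-- Weighted sum over the possible cardinalities of a row. -/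
def wsumD (f : ℕ → ℕ) : ℕ := f 0 + 3 * f 1 + 3 * f 2 + f 3

lemma sum_by_card (f : ℕ → ℕ) :
    ∑ A : Finset (Fin 3), f A.card = wsumD f := by
  have h := Finset.sum_powerset_apply_card f (x := (univ : Finset (Fin 3)))
  rw [Finset.powerset_univ] at h
  rw [h]
  simp [Finset.sum_range_succ, Nat.choose, wsumD]

lemma count_eq : {U : Finset (Fin 4 × Fin 3) | IsFacetD 4 U}.ncard = 648 := by
  have hs : {U : Finset (Fin 4 × Fin 3) | IsFacetD 4 U} =
      ((univ.filter (fun U : Finset (Fin 4 × Fin 3) =>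
        badB (rowD U 0).card (rowD U 1).card (rowD U 2).card (rowD U 3).card = false ∧
        (rowD U 0).card + (rowD U 1).card + (rowD U 2).card + (rowD U 3).card = 7) :
        Finset _) : Set (Finset (Fin 4 × Fin 3))) := by
    ext U
    simp only [Set.mem_ofPred_eq, facet_iff, isFaceD_iff', card_eq_sum_profile, profileOf_eq_row,
      coe_filter, mem_univ, true_and]
  rw [hs, Set.ncard_coe_finset, Finset.card_filter]
  have key : ∑ U : Finset (Fin 4 × Fin 3),
      facetInd (rowD U 0).card (rowD U 1).card (rowD U 2).card (rowD U 3).card =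
      ∑ g : Finset (Fin 3) × Finset (Fin 3) × Finset (Fin 3) × Finset (Fin 3),
        facetInd g.1.card g.2.1.card g.2.2.1.card g.2.2.2.card :=
    Equiv.sum_comp rowsEquivD (fun g => facetInd g.1.card g.2.1.card g.2.2.1.card g.2.2.2.card)
  refine key.trans ?_
  simp only [Fintype.sum_prod_type]
  simp only [fun a b c => sum_by_card (fun d => facetInd a b c d)]
  simp only [fun a b => sum_by_card (fun c => wsumD (fun d => facetInd a b c d))]
  simp only [fun a => sum_by_card (fun b => wsumD (fun c => wsumD (fun d => facetInd a b c d)))]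
  rw [sum_by_card (fun a => wsumD (fun b => wsumD (fun c => wsumD (fun d => facetInd a b c d))))]
  decide +kernel

/-- For `n = 4`: the complex `Δ₄` on the 12-element ground set is pure of
dimension 6 (every facet has 7 elements) and has exactly 648 facets. -/
theorem Delta_four_pure_and_648_facets :
    (∀ U : Finset (Fin 4 × Fin 3), IsFacetD 4 U → U.card = 7) ∧
    (∃ U : Finset (Fin 4 × Fin 3), IsFacetD 4 U) ∧
    {U : Finset (Fin 4 × Fin 3) | IsFacetD 4 U}.ncard = 648 := by
  refine ⟨facet_card, ?_, count_eq⟩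
  have h : {U : Finset (Fin 4 × Fin 3) | IsFacetD 4 U}.Nonempty := by
    apply Set.nonempty_of_ncard_ne_zero
    rw [count_eq]
    decide
  exact h
end

section
/- Let V ⊆ ℂᴺ be an irreducible variety and f₁,…,f_r nonzero polynomials in I(V). Suppose that for every facet U of the simplicial complex Δ(f₁,…,f_r) (whose nonfaces are generated by the spreads of the fᵢ), the projection π̄_U : V̄ → (ℙ¹)ᵁ is surjective. Then Δ(f₁,…,f_r) equals the algebraic matroid of V; in particular it is a pure complex of dimension dim V − 1. -/
open MvPolynomial

noncomputable section

/-- The complex projective line `ℙ¹`. -/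
abbrev P1 := Projectivization ℂ (ℂ × ℂ)

/-- The standard affine chart `ℂ ↪ ℙ¹`, `x ↦ [x : 1]`. -/
def embedC (x : ℂ) : P1 :=
  Projectivization.mk ℂ (x, 1) (by simp)

/-- The embedding `ℂᴺ ↪ (ℙ¹)ᴺ`, homogenizing each coordinate. -/
def embedAff {ι : Type*} (v : ι → ℂ) : ι → P1 := fun i => embedC (v i)

/-- `f` (in the doubled variables, `Sum.inl i` paired with `Sum.inr i`) is
multihomogeneous of multidegree `d`. -/
def MultiHomog {ι : Type*} (f : MvPolynomial (ι ⊕ ι) ℂ) (d : ι → ℕ) : Prop :=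
  ∀ m ∈ f.support, ∀ i : ι, m (Sum.inl i) + m (Sum.inr i) = d i

/-- Evaluation of a polynomial in doubled variables at a point of `(ℙ¹)^ι`,
using chosen homogeneous coordinates. -/
def pEval {ι : Type*} (f : MvPolynomial (ι ⊕ ι) ℂ) (p : ι → P1) : ℂ :=
  eval (Sum.elim (fun i => (p i).rep.1) (fun i => (p i).rep.2)) f

/-- Zariski-closed subsets of `(ℙ¹)^ι`: common zero sets of collections of
multihomogeneous polynomials. -/
def MClosed {ι : Type*} (C : Set (ι → P1)) : Prop :=
  ∃ F : Set (MvPolynomial (ι ⊕ ι) ℂ),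
    (∀ f ∈ F, ∃ d : ι → ℕ, MultiHomog f d) ∧
    C = {p | ∀ f ∈ F, pEval f p = 0}

/-- The multiprojective (Zariski) closure of a subset of `(ℙ¹)^ι`. -/
def mClosure {ι : Type*} (A : Set (ι → P1)) : Set (ι → P1) :=
  ⋂₀ {C | MClosed C ∧ A ⊆ C}

/-- Zariski-closed subsets of affine space `ℂ^ι`: zero sets of collections of
polynomials.  `IsAffineVariety V` says `V` is such a zero set. -/
def IsAffineVariety {ι : Type*} (V : Set (ι → ℂ)) : Prop :=
  ∃ F : Set (MvPolynomial ι ℂ), V = {x | ∀ f ∈ F, eval x f = 0}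

/-- `V` is irreducible (in the Zariski topology on `ℂ^ι`). -/
def IsIrredVariety {ι : Type*} (V : Set (ι → ℂ)) : Prop :=
  V.Nonempty ∧ ∀ C₁ C₂ : Set (ι → ℂ), IsAffineVariety C₁ → IsAffineVariety C₂ →
    V ⊆ C₁ ∪ C₂ → V ⊆ C₁ ∨ V ⊆ C₂

/-- The coordinate projection `(ℙ¹)^ι → (ℙ¹)^U`. -/
def projP {ι : Type*} (U : Set ι) (p : ι → P1) : U → P1 := fun u => p u

/-- The coordinate projection `π_U : V → ℂ^U` is dominant: its image is Zariski
dense, i.e. no nonzero polynomial in the variables indexed by `U` vanishes on it. -/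
def DominantProj {ι : Type*} (V : Set (ι → ℂ)) (U : Set ι) : Prop :=
  ∀ f : MvPolynomial U ℂ, (∀ v ∈ V, eval (fun u : U => v u) f = 0) → f = 0

/-- The vanishing ideal `I(V) ⊆ ℂ[x_i : i ∈ ι]` of a subset `V ⊆ ℂ^ι`. -/
def vanIdealOf {ι : Type*} (V : Set (ι → ℂ)) : Ideal (MvPolynomial ι ℂ) where
  carrier := {f | ∀ v ∈ V, eval v f = 0}
  add_mem' := by
    intro a b ha hb v hv
    simp [map_add, ha v hv, hb v hv]
  zero_mem' := by
    intro v hv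
    simp
  smul_mem' := by
    intro c a ha v hv
    simp [smul_eq_mul, map_mul, ha v hv]

/-- The coordinate ring `ℂ[x]/I(V)` of `V`. -/
abbrev coordRing {ι : Type*} (V : Set (ι → ℂ)) : Type _ :=
  MvPolynomial ι ℂ ⧸ vanIdealOf V

/-- The function field `ℂ(V)` of (an irreducible) `V`. -/
abbrev funcField {ι : Type*} (V : Set (ι → ℂ)) : Type _ :=
  FractionRing (coordRing V)

/-- Independence in the algebraic matroid of `V`: a set `U` of coordinates is
independent iff the coordinate functions `{x_i : i ∈ U}` are algebraically
independent over `ℂ` in the function field `ℂ(V)`. -/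
def AlgIndepOn {ι : Type*} (V : Set (ι → ℂ)) (U : Finset ι) : Prop :=
  AlgebraicIndependent ℂ (fun i : ↥U =>
    algebraMap (coordRing V) (funcField V)
      (Ideal.Quotient.mk (vanIdealOf V) (X (i : ι))))

/-- `U` is a face of the complex `Δ(f₁,…,f_r)`: it contains the spread
(set of variables) of no `f i`. -/
def IsFaceHL {ι : Type*} {r : ℕ} (f : Fin r → MvPolynomial ι ℂ)
    (U : Finset ι) : Prop :=
  ¬ ∃ i : Fin r, (f i).vars ⊆ U

/-- Integral injective extensions preserve Krull dimension. -/
lemma aux_dim_integral {R S : Type*} [CommRing R] [CommRing S] [Algebra R S]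
    [Algebra.IsIntegral R S] [FaithfulSMul R S] : ringKrullDim S = ringKrullDim R := by
  apply le_antisymm
  · refine Order.krullDim_le_of_strictMono (PrimeSpectrum.comap (algebraMap R S)) ?_
    intro I J hIJ
    exact Ideal.IsIntegral.comap_lt_comap (I := I.asIdeal) (J := J.asIdeal) hIJ
  · refine iSup_le fun l => ?_
    obtain ⟨Q, hQ1, hQ2⟩ := Ideal.nonempty_primesOver (S := S) (RelSeries.head l).asIdeal
    obtain ⟨L, hL, -⟩ := Ideal.exists_ltSeries_of_hasGoingUp l Q
    rw [← hL]
    exact Order.LTSeries.length_le_krullDim L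

/-- Krull dimension from a transcendence basis. -/
lemma aux_dim_trbasis {A : Type} [CommRing A] [IsDomain A] [Algebra ℂ A]
    [Algebra.FiniteType ℂ A] {ι : Type} [Fintype ι] (x : ι → A)
    (hx : IsTranscendenceBasis ℂ x) :
    (Fintype.card ι : WithBot ℕ∞) = ringKrullDim A := by
  obtain ⟨s, g, hg, hint⟩ := exists_integral_inj_algHom_of_fg ℂ A
  let : Algebra (MvPolynomial (Fin s) ℂ) A := g.toRingHom.toAlgebra
  have : IsScalarTower ℂ (MvPolynomial (Fin s) ℂ) A :=
    IsScalarTower.of_algebraMap_eq fun r => (g.commutes r).symm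
  have : Algebra.IsIntegral (MvPolynomial (Fin s) ℂ) A := ⟨hint⟩
  have : FaithfulSMul (MvPolynomial (Fin s) ℂ) A :=
    (faithfulSMul_iff_algebraMap_injective _ _).mpr hg
  rw [aux_dim_integral (R := MvPolynomial (Fin s) ℂ) (S := A),
    MvPolynomial.ringKrullDim_of_isNoetherianRing, ringKrullDim_eq_zero_of_field]
  have h1 : IsTranscendenceBasis ℂ
      (algebraMap (MvPolynomial (Fin s) ℂ) A ∘ (X : Fin s → MvPolynomial (Fin s) ℂ)) :=
    (IsTranscendenceBasis.mvPolynomial (Fin s) ℂ).algebraMap_comp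
  have h2 := hx.cardinalMk_eq h1
  have h3 : Fintype.card ι = s := by simpa using h2
  simp [h3]

lemma aux_rep (x : ℂ) : ∃ c : ℂ, c ≠ 0 ∧ (embedC x).rep.1 = c * x ∧ (embedC x).rep.2 = c := by
  obtain ⟨a, ha⟩ := Projectivization.exists_smul_eq_mk_rep ℂ ((x, 1) : ℂ × ℂ) (by simp)
  refine ⟨a, a.ne_zero, ?_, ?_⟩
  · rw [embedC, ← ha]; simp [Units.smul_def]
  · rw [embedC, ← ha]; simp [Units.smul_def]

/-- exponent of a homogenized monomial -/
def auxExp {N : ℕ} (d m : Fin N →₀ ℕ) : (Fin N ⊕ Fin N) →₀ ℕ :=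
  Finsupp.equivFunOnFinite.symm (Sum.elim (fun i => m i) (fun i => d i - m i))

/-- multihomogenization -/
def auxHom {N : ℕ} (g : MvPolynomial (Fin N) ℂ) : MvPolynomial (Fin N ⊕ Fin N) ℂ :=
  ∑ m ∈ g.support, monomial
    (auxExp (Finsupp.equivFunOnFinite.symm fun i => g.degreeOf i) m) (g.coeff m)

lemma auxHom_multiHomog {N : ℕ} (g : MvPolynomial (Fin N) ℂ) :
    MultiHomog (auxHom g) (fun i => g.degreeOf i) := by
  classical
  intro m hm i
  obtain ⟨k, hk, hmk⟩ := Finset.mem_biUnion.mp (MvPolynomial.support_sum hm)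
  have := Finset.mem_singleton.mp (support_monomial_subset hmk)
  subst this
  have := monomial_le_degreeOf i hk
  simp [auxExp]
  omega

lemma auxHom_eval {N : ℕ} (g : MvPolynomial (Fin N) ℂ) (p : Fin N → P1) (v : Fin N → ℂ)
    (h : ∀ i, g.degreeOf i = 0 ∨ p i = embedC (v i)) :
    pEval (auxHom g) p = 0 ↔ eval v g = 0 := by
  have hc : ∀ i, ∃ c : ℂ, c ≠ 0 ∧ (g.degreeOf i = 0 ∨
      ((p i).rep.1 = c * v i ∧ (p i).rep.2 = c)) := by
    intro i
    rcases h i with h | h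
    · exact ⟨1, one_ne_zero, Or.inl h⟩
    · obtain ⟨c, h0, h1⟩ := aux_rep (v i)
      exact ⟨c, h0, Or.inr (by rw [h]; exact h1)⟩
  choose c hc0 hc using hc
  have key : pEval (auxHom g) p = (∏ i, c i ^ g.degreeOf i) * eval v g := by
    rw [eval_eq', Finset.mul_sum, pEval, auxHom, map_sum]
    refine Finset.sum_congr rfl fun m hm => ?_
    rw [eval_monomial, Finsupp.prod_fintype _ _ (by simp), Fintype.prod_sum_type]
    simp only [auxExp, Finsupp.equivFunOnFinite_symm_apply_apply, Sum.elim_inl, Sum.elim_inr]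
    rw [← Finset.prod_mul_distrib, mul_left_comm, ← Finset.prod_mul_distrib]
    congr 1
    refine Finset.prod_congr rfl fun i _ => ?_
    have hle := monomial_le_degreeOf i hm
    rcases hc i with h | ⟨h1, h2⟩
    · have : m i = 0 := by omega
      simp [h, this]
    · rw [h1, h2, mul_pow]
      obtain ⟨k, hk⟩ := Nat.exists_eq_add_of_le hle
      rw [hk]
      simp [pow_add]
      ring
  rw [key, mul_eq_zero, or_iff_right]
  exact Finset.prod_ne_zero_iff.mpr fun i _ => pow_ne_zero _ (hc0 i)

lemma aux_closure {N : ℕ} (V : Set (Fin N → ℂ)) (g : MvPolynomial (Fin N) ℂ)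
    (hg : ∀ v ∈ V, eval v g = 0) (p : Fin N → P1) (hp : p ∈ mClosure (embedAff '' V)) :
    pEval (auxHom g) p = 0 := by
  refine Set.mem_sInter.mp hp {p | pEval (auxHom g) p = 0} ⟨⟨{auxHom g}, ?_, ?_⟩, ?_⟩
  · rintro f rfl
    exact ⟨_, auxHom_multiHomog g⟩
  · simp
  · rintro _ ⟨v, hv, rfl⟩
    exact (auxHom_eval g _ v fun i => Or.inr rfl).mpr (hg v hv)

lemma aux_indep_iff {N : ℕ} (V : Set (Fin N → ℂ)) (U : Finset (Fin N)) :
    AlgIndepOn V U ↔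
      AlgebraicIndepOn ℂ (fun i => Ideal.Quotient.mk (vanIdealOf V) (X i)) (U : Set (Fin N)) := by
  have := AlgHom.algebraicIndependent_iff (R := ℂ)
    (x := fun i : U => Ideal.Quotient.mk (vanIdealOf V) (X (i : Fin N)))
    (IsScalarTower.toAlgHom ℂ (coordRing V) (funcField V))
    (IsFractionRing.injective (coordRing V) (funcField V))
  exact this

lemma aux_indep_iff_eval {N : ℕ} (V : Set (Fin N → ℂ)) (U : Finset (Fin N)) :
    AlgIndepOn V U ↔ ∀ g : MvPolynomial U ℂ,
      (∀ v ∈ V, eval v (rename Subtype.val g) = 0) → g = 0 := by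
  rw [aux_indep_iff, AlgebraicIndepOn, algebraicIndependent_iff]
  refine forall_congr' fun g => imp_congr_left ?_
  have : aeval (fun i : (U : Set (Fin N)) => Ideal.Quotient.mk (vanIdealOf V) (X (i : Fin N))) g
      = Ideal.Quotient.mk (vanIdealOf V) (rename Subtype.val g) := by
    have h : aeval (fun i : (U : Set (Fin N)) => Ideal.Quotient.mk (vanIdealOf V) (X (i : Fin N)))
        = (Ideal.Quotient.mkₐ ℂ (vanIdealOf V)).comp (rename Subtype.val) := by
      apply MvPolynomial.algHom_ext
      intro i
      simp
    rw [h]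
    rfl
  rw [this, Ideal.Quotient.eq_zero_iff_mem]
  rfl

lemma aux_prime {N : ℕ} (V : Set (Fin N → ℂ)) (hirr : IsIrredVariety V) :
    (vanIdealOf V).IsPrime := by
  obtain ⟨⟨v, hv⟩, h⟩ := hirr
  refine ⟨?_, ?_⟩
  · rw [Ideal.ne_top_iff_one]
    intro h1
    simpa using h1 v hv
  · intro a b hab
    have := h {x | eval x a = 0} {x | eval x b = 0} ⟨{a}, by simp⟩ ⟨{b}, by simp⟩ (by
      intro x hx
      have := hab x hx
      rw [map_mul, mul_eq_zero] at this
      exact this)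
    exact this

lemma aux_maximal {N : ℕ} (V : Set (Fin N → ℂ)) (hirr : IsIrredVariety V) (U : Finset (Fin N))
    (hU : AlgIndepOn V U) (hmax : ∀ W : Finset (Fin N), AlgIndepOn V W → U ⊆ W → W = U) :
    (U.card : WithBot ℕ∞) = ringKrullDim (coordRing V) := by
  have := aux_prime V hirr
  have : IsDomain (coordRing V) := Ideal.Quotient.isDomain _
  rw [aux_indep_iff] at hU
  set x : Fin N → coordRing V := fun i => Ideal.Quotient.mk (vanIdealOf V) (X i) with hx
  have hb : IsTranscendenceBasis ℂ (fun i : U => x i) := by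
    refine (AlgebraicIndependent.isTranscendenceBasis_iff_isAlgebraic hU).mpr ?_
    have hr : Set.range (fun i : (U : Set (Fin N)) => x i) = x '' U := by
      rw [Set.image_eq_range]
    rw [hr]
    have hX : ∀ j, IsAlgebraic (Algebra.adjoin ℂ (x '' U)) (x j) := by
      intro j
      by_contra hj
      have h1 : AlgebraicIndepOn ℂ x (insert j (U : Set (Fin N))) :=
        AlgebraicIndepOn.insert hU hj
      rw [← Finset.coe_insert, ← aux_indep_iff] at h1
      have h2 := hmax _ h1 (Finset.subset_insert _ _)
      have h3 : j ∈ U := by rw [← h2]; exact Finset.mem_insert_self _ _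
      exact hj (isAlgebraic_algebraMap
        (⟨x j, Algebra.subset_adjoin ⟨j, h3, rfl⟩⟩ : Algebra.adjoin ℂ (x '' U)))
    refine ⟨fun a => ?_⟩
    obtain ⟨q, rfl⟩ := Ideal.Quotient.mk_surjective a
    induction q using MvPolynomial.induction_on with
    | C c => exact isAlgebraic_algebraMap (algebraMap ℂ (Algebra.adjoin ℂ (x '' U)) c)
    | add p q hp hq => rw [map_add]; exact hp.add hq
    | mul_X p i hp => rw [map_mul]; exact hp.mul (hX i)
  have := aux_dim_trbasis _ hb
  rw [← this]
  simp

lemma aux_facet_indep {N : ℕ} (V : Set (Fin N → ℂ)) (U : Finset (Fin N))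
    (h : projP (↑U : Set (Fin N)) '' mClosure (embedAff '' V) = Set.univ) :
    AlgIndepOn V U := by
  classical
  rw [aux_indep_iff_eval]
  intro g hg
  apply MvPolynomial.funext
  intro w
  obtain ⟨p, hp, hpw⟩ : (fun u : (U : Set (Fin N)) => embedC (w u)) ∈
      projP (↑U : Set (Fin N)) '' mClosure (embedAff '' V) := by rw [h]; trivial
  have h0 := aux_closure V _ hg p hp
  let v : Fin N → ℂ := fun i => if hi : i ∈ U then w ⟨i, hi⟩ else 0
  rw [auxHom_eval _ p v] at h0
  · rw [eval_rename] at h0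
    have : v ∘ (Subtype.val : U → Fin N) = w := by
      ext u
      simp [v]
    rw [this] at h0
    simpa using h0
  · intro i
    by_cases hi : i ∈ U
    · right
      have := congrFun hpw ⟨i, hi⟩
      simpa [v, hi, projP] using this
    · left
      rw [← Nat.le_zero, degreeOf_le_iff]
      intro m hm
      by_contra hmi
      replace hmi : m i ≠ 0 := fun h => hmi h.le
      have : i ∈ (rename Subtype.val g).vars :=
        (mem_vars i).mpr ⟨m, hm, Finsupp.mem_support_iff.mpr hmi⟩
      have := vars_rename _ _ this
      simp at this
      exact hi this.1

lemma aux_indep_face {N : ℕ} (V : Set (Fin N → ℂ)) {r : ℕ}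
    (f : Fin r → MvPolynomial (Fin N) ℂ)
    (hf0 : ∀ i, f i ≠ 0) (hfI : ∀ i, ∀ v ∈ V, eval v (f i) = 0) (U : Finset (Fin N))
    (h : AlgIndepOn V U) : IsFaceHL f U := by
  rintro ⟨i, hi⟩
  rw [aux_indep_iff_eval] at h
  obtain ⟨g, hg⟩ := exists_rename_eq_of_vars_subset_range (f i)
    (Subtype.val : U → Fin N) Subtype.val_injective (by
      intro j hj
      exact ⟨⟨j, hi hj⟩, rfl⟩)
  have : g = 0 := h g (by rw [hg]; exact hfI i)
  apply hf0 i
  rw [← hg, this, map_zero]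

/-- Huang–Larson: if `V ⊆ ℂᴺ` is irreducible, `f₁,…,f_r` are nonzero elements
of `I(V)`, and for every facet `U` of `Δ(f₁,…,f_r)` the projection
`π̄_U : V̄ → (ℙ¹)ᵁ` is surjective, then `Δ(f₁,…,f_r)` coincides with the
algebraic matroid of `V`; in particular it is pure of dimension `dim V − 1`,
i.e. every facet has `dim V` elements. -/
theorem HL_complex_is_algebraic_matroid {N : ℕ} (V : Set (Fin N → ℂ))
    (hV : IsAffineVariety V) (hirr : IsIrredVariety V)
    {r : ℕ} (f : Fin r → MvPolynomial (Fin N) ℂ)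
    (hf0 : ∀ i, f i ≠ 0) (hfI : ∀ i, ∀ v ∈ V, eval v (f i) = 0)
    (hsurj : ∀ U : Finset (Fin N),
      (IsFaceHL f U ∧ ∀ W : Finset (Fin N), IsFaceHL f W → U ⊆ W → W = U) →
      projP (↑U : Set (Fin N)) '' mClosure (embedAff '' V) = Set.univ) :
    (∀ U : Finset (Fin N), IsFaceHL f U ↔ AlgIndepOn V U) ∧
    (∀ U : Finset (Fin N),
      (IsFaceHL f U ∧ ∀ W : Finset (Fin N), IsFaceHL f W → U ⊆ W → W = U) →
      (U.card : WithBot ℕ∞) = ringKrullDim (coordRing V)) := by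
  have hiff : ∀ U : Finset (Fin N), IsFaceHL f U ↔ AlgIndepOn V U := by
    intro U
    refine ⟨fun hU => ?_, aux_indep_face V f hf0 hfI U⟩
    obtain ⟨W, hUW, hW⟩ := (Set.toFinite {W : Finset (Fin N) | IsFaceHL f W}).exists_le_maximal hU
    have h1 := aux_facet_indep V W (hsurj W ⟨hW.1, fun Y hY hs =>
      le_antisymm (hW.2 hY hs) hs⟩)
    rw [aux_indep_iff] at h1 ⊢
    exact AlgebraicIndepOn.mono h1 (Finset.coe_subset.mpr hUW)
  refine ⟨hiff, fun U hU => aux_maximal V hirr U ((hiff U).mp hU.1) fun W hW hs =>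
    hU.2 W ((hiff W).mpr hW) hs⟩

end
end
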